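/- Let m ≥ 2, (m−1)/2 ≤ a ≤ m−1, and α₁,…,α_{m−1} ∈ ℝ, and set Q(u) = ∏_{j=1}^a (α_j+u) · ∏_{j=a+1}^{m−1} (α_j−u). Let u, θ₁,…,θ_{m−1} : (−ε,ε) → ℝ be differentiable with θ = θ₁+⋯+θ_{m−1}, satisfying α_j + u(t) > 0 for j ≤ a, α_j − u(t) > 0 for a < j ≤ m−1, du/dt = 2Q(u)^{1/2} cos θ, dθ_j/dt = −Q(u)^{1/2} sin θ/(α_j+u) for j ≤ a, and dθ_j/dt = Q(u)^{1/2} sin θ/(α_j−u) for a < j ≤ m−1. Then Q(u(t))^{1/2} sin θ(t) = A is constant on (−ε,ε); and, defining w_j(t) = e^{iθ_j(t)}√(α_j+u(t)) for j ≤ a and w_j(t) = e^{iθ_j(t)}√(α_j−u(t)) for a < j ≤ m−1 and β(t) = ½u(t) − iAt, for every t ∈ (−ε,ε) and every x ∈ ℝᵐ with x₁²+⋯+x_a² − x_{a+1}²−⋯−x_{m−1}² + 2x_m = 0, the real subspace of ℂᵐ spanned by (w₁′(t)x₁,…,w_{m−1}′(t)x_{m−1}, β′(t)) together with all vectors (w₁(t)y₁,…,w_{m−1}(t)y_{m−1},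 y_m) for y ∈ ℝᵐ with x₁y₁+⋯+x_ay_a − x_{a+1}y_{a+1}−⋯−x_{m−1}y_{m−1} + y_m = 0 is, whenever it has real dimension m, a special Lagrangian plane; hence the set N = {(w₁(t)x₁,…,w_{m−1}(t)x_{m−1}, x_m + ½u(t) − iAt) : t ∈ (−ε,ε), x ∈ ℝᵐ, x₁²+⋯+x_a² − x_{a+1}²−⋯−x_{m−1}² + 2x_m = 0} is a special Lagrangian submanifold of ℂᵐ wherever it is nonsingular. -/

import Mathlib

open scoped ComplexConjugate

/-- The standard Hermitian inner product on `ℂ^m`. -/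
noncomputable def hermInner {m : ℕ} (v w : Fin m → ℂ) : ℂ :=
  ∑ j, v j * conj (w j)

/-- The standard symplectic form `ω(v,w) = Im ⟨v,w⟩` on `ℂ^m` viewed as a real vector space. -/
noncomputable def omegaForm {m : ℕ} (v w : Fin m → ℂ) : ℝ :=
  (hermInner v w).im

/-- The holomorphic volume form: the determinant of the complex `m × m` matrix with
columns `v 0, …, v (m-1)`. -/
noncomputable def OmegaForm {m : ℕ} (v : Fin m → (Fin m → ℂ)) : ℂ :=
  Matrix.det (Matrix.of fun i j => v j i)

/-- A real subspace `V ⊆ ℂ^m` is a special Lagrangian plane if it has real dimension `m`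
and both `ω` and `Im Ω` vanish identically on it. -/
def IsSpecialLagrangianPlane {m : ℕ} (V : Submodule ℝ (Fin m → ℂ)) : Prop :=
  Module.finrank ℝ V = m ∧
  (∀ v ∈ V, ∀ w ∈ V, omegaForm v w = 0) ∧
  (∀ v : Fin m → (Fin m → ℂ), (∀ i, v i ∈ V) → (OmegaForm v).im = 0)

/-- Sign `+1` for the first `a` indices, `-1` for the rest. -/
def qsign (a : ℕ) {m : ℕ} (j : Fin m) : ℝ := if (j : ℕ) < a then 1 else -1

/-- `Q(v) = ∏_{j=1}^a (α_j + v) · ∏_{j=a+1}^{m} (α_j − v)`. -/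
def quadProd (a : ℕ) {m : ℕ} (α : Fin m → ℝ) (v : ℝ) : ℝ :=
  ∏ j : Fin m, if (j : ℕ) < a then α j + v else α j - v

/-- The functions `w_j(t) = e^{iθ_j(t)} √(α_j ± u(t))`. -/
noncomputable def wFun (a : ℕ) {m : ℕ} (α : Fin m → ℝ) (u : ℝ → ℝ) (θ : Fin m → ℝ → ℝ)
    (j : Fin m) (t : ℝ) : ℂ :=
  Complex.exp (Complex.I * (θ j t : ℝ)) *
    (Real.sqrt (if (j : ℕ) < a then α j + u t else α j - u t) : ℝ)

lemma Matrix.det_add_smul_vecMulVec {n R : Type*} [Fintype n] [DecidableEq n] [CommRing R]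
    (Y : Matrix n n R) (κ : R) (ξ c : n → R) :
    (Y + κ • Matrix.vecMulVec ξ c).det = Y.det + κ * (Matrix.fromBlocks Y
      (Matrix.replicateCol Unit ξ) (-Matrix.replicateRow Unit c) 0).det := by
  set G : Matrix (n ⊕ Unit) (n ⊕ Unit) R := Matrix.fromBlocks Y 0 (-Matrix.replicateRow Unit c) 1
  have h1 : (Y + κ • Matrix.vecMulVec ξ c).det = (Matrix.fromBlocks Y
      (κ • Matrix.replicateCol Unit ξ) (-Matrix.replicateRow Unit c) 1).det := by
    rw [Matrix.det_fromBlocks_one₂₂]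
    congr 1
    ext i j
    simp [Matrix.mul_apply, Matrix.vecMulVec_apply]
  have h2 : Matrix.fromBlocks Y (κ • Matrix.replicateCol Unit ξ)
      (-Matrix.replicateRow Unit c) 1 =
      G.updateCol (Sum.inr ()) ((Sum.elim 0 1 : n ⊕ Unit → R) + κ • (Sum.elim ξ 0 : n ⊕ Unit → R)) := by
    ext i j
    rcases i with i | i <;> rcases j with j | j <;> simp [G]
  have h3 : G.updateCol (Sum.inr ()) (Sum.elim 0 1 : n ⊕ Unit → R) = G := by
    ext i j
    rcases i with i | i <;> rcases j with j | j <;> simp [G]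
  have h4 : G.updateCol (Sum.inr ()) (Sum.elim ξ 0 : n ⊕ Unit → R) = Matrix.fromBlocks Y
      (Matrix.replicateCol Unit ξ) (-Matrix.replicateRow Unit c) 0 := by
    ext i j
    rcases i with i | i <;> rcases j with j | j <;> simp [G]
  rw [h1, h2, Matrix.det_updateCol_add, Matrix.det_updateCol_smul, h3, h4,
    Matrix.det_fromBlocks_zero₁₂, Matrix.det_one, mul_one]

/-- A real `N`-dimensional space of vectors `W · (y + c κ ξ)`, with `c` real and `y` in a fixed
real hyperplane, is special Lagrangian if the normal of the hyperplane is `|W|² ξ` and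
`κ ∏ W` is real. -/
lemma isSpecialLagrangianPlane_of_diagonal {N : ℕ} {W : Fin N → ℂ} {ξ n : Fin N → ℝ} {κ : ℂ}
    (hn : ∀ i, n i = Complex.normSq (W i) * ξ i) (hn0 : n ≠ 0)
    (hκ : ((∏ i, W i) * κ).im = 0) {V : Submodule ℝ (Fin N → ℂ)}
    (hV : ∀ v ∈ V, ∃ (c : ℝ) (y : Fin N → ℝ), ∑ i, n i * y i = 0 ∧
      ∀ i, v i = W i * (y i + c * κ * ξ i))
    (hdim : Module.finrank ℝ V = N) : IsSpecialLagrangianPlane V := by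
  refine ⟨hdim, ?_, ?_⟩
  · intro v hv w hw
    obtain ⟨c, y, hy, hvy⟩ := hV v hv
    obtain ⟨d, z, hz, hwz⟩ := hV w hw
    have key : ∀ i, (v i * conj (w i)).im =
        c * κ.im * (n i * z i) - d * κ.im * (n i * y i) := by
      intro i
      rw [hvy, hwz, hn, Complex.normSq_apply]
      simp
      ring
    rw [omegaForm, hermInner, Complex.im_sum, Finset.sum_congr rfl fun i _ => key i,
      Finset.sum_sub_distrib, ← Finset.mul_sum, ← Finset.mul_sum, hy, hz]
    ring
  · intro v hv
    choose c y hy hvy using fun i => hV (v i) (hv i)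
    set Y : Matrix (Fin N) (Fin N) ℝ := Matrix.of fun i j => y j i
    have hY : Y.det = 0 := by
      refine Matrix.exists_vecMul_eq_zero_iff.1 ⟨n, hn0, ?_⟩
      ext j
      simpa [Matrix.vecMul, dotProduct, Y] using hy j
    have hM : (Matrix.of fun i j => v j i) = Matrix.diagonal W *
        (Y.map Complex.ofRealHom + κ • Matrix.vecMulVec (fun i => (ξ i : ℂ)) fun i => (c i : ℂ)) := by
      ext i j
      simp [Matrix.diagonal_mul, hvy, Matrix.vecMulVec_apply, Y]
      ring_nf
      simp
    have hB : Matrix.fromBlocks (Y.map Complex.ofRealHom)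
        (Matrix.replicateCol Unit fun i => (ξ i : ℂ))
        (-Matrix.replicateRow Unit fun i => (c i : ℂ)) 0 =
        (Matrix.fromBlocks Y (Matrix.replicateCol Unit ξ)
          (-Matrix.replicateRow Unit c) 0).map Complex.ofRealHom := by
      ext i j
      rcases i with i | i <;> rcases j with j | j <;> simp
    have hmap : ∀ {k : Type} [Fintype k] [DecidableEq k] (M : Matrix k k ℝ),
        (M.map Complex.ofRealHom).det = (M.det : ℂ) := fun M =>
      (RingHom.map_det Complex.ofRealHom M).symm
    rw [OmegaForm, hM, Matrix.det_mul, Matrix.det_diagonal, Matrix.det_add_smul_vecMulVec, hB,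
      hmap, hmap, hY, Complex.ofReal_zero, zero_add, ← mul_assoc, Complex.im_mul_ofReal, hκ,
      zero_mul]

lemma ite_add_sub_eq_qsign (a : ℕ) {m : ℕ} (j : Fin m) (x v : ℝ) :
    (if (j : ℕ) < a then x + v else x - v) = x + qsign a j * v := by
  unfold qsign
  split_ifs <;> ring

lemma normSq_wFun {a m : ℕ} {α : Fin m → ℝ} {u : ℝ → ℝ} {θ : Fin m → ℝ → ℝ} {j : Fin m} {t : ℝ}
    (hρ : 0 < α j + qsign a j * u t) :
    Complex.normSq (wFun a α u θ j t) = α j + qsign a j * u t := by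
  rw [wFun, ite_add_sub_eq_qsign, mul_comm Complex.I, Complex.normSq_mul, Complex.normSq_ofReal,
    Real.mul_self_sqrt hρ.le, Complex.normSq_eq_norm_sq, Complex.norm_exp_ofReal_mul_I]
  ring

lemma prod_wFun {a m : ℕ} {α : Fin m → ℝ} {u : ℝ → ℝ} {θ : Fin m → ℝ → ℝ} {t : ℝ}
    (hρ : ∀ j, 0 < α j + qsign a j * u t) :
    ∏ j, wFun a α u θ j t = (Real.sqrt (quadProd a α (u t)) : ℝ) *
      ((Real.cos (∑ j, θ j t) : ℝ) + (Real.sin (∑ j, θ j t) : ℝ) * Complex.I) := by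
  simp only [wFun, quadProd, ite_add_sub_eq_qsign]
  rw [Finset.prod_mul_distrib, ← Complex.exp_sum, Real.sqrt_prod _ fun j _ => (hρ j).le,
    ← Finset.mul_sum, mul_comm Complex.I, ← Complex.ofReal_sum, Complex.exp_mul_I,
    Complex.ofReal_prod, Complex.ofReal_cos, Complex.ofReal_sin, mul_comm]

lemma hasDerivAt_wFun {a m : ℕ} {α : Fin m → ℝ} {u : ℝ → ℝ} {θ : Fin m → ℝ → ℝ} {j : Fin m}
    {t S c s : ℝ} (hρ : 0 < α j + qsign a j * u t) (hu : HasDerivAt u (2 * S * c) t)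
    (hθ : HasDerivAt (θ j) (-(qsign a j * (S * s)) / (α j + qsign a j * u t)) t) :
    HasDerivAt (wFun a α u θ j) (wFun a α u θ j t * ((S : ℂ) * (c - s * Complex.I) *
      ((qsign a j / (α j + qsign a j * u t) : ℝ) : ℂ))) t := by
  have hr : HasDerivAt (fun τ => Real.sqrt (α j + qsign a j * u τ))
      (qsign a j * (2 * S * c) / (2 * Real.sqrt (α j + qsign a j * u t))) t :=
    ((hu.const_mul (qsign a j)).const_add (α j)).sqrt hρ.ne'
  have he := (hθ.ofReal_comp.const_mul Complex.I).cexp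
  have h := he.mul hr.ofReal_comp
  have hfun : wFun a α u θ j = fun τ => Complex.exp (Complex.I * (θ j τ : ℝ)) *
      (Real.sqrt (α j + qsign a j * u τ) : ℝ) := by
    funext τ
    rw [wFun, ite_add_sub_eq_qsign]
  rw [hfun]
  refine h.congr_deriv ?_
  have hρr := Real.sq_sqrt hρ.le
  have hr0 := (Real.sqrt_pos.2 hρ).ne'
  set r := Real.sqrt (α j + qsign a j * u t)
  rw [← hρr]
  have hr0' : (r : ℂ) ≠ 0 := by exact_mod_cast hr0
  push_cast
  field_simp
  ring

lemma exists_sqrt_quadProd_mul_sin_eq {m a : ℕ} {α : Fin m → ℝ} {u : ℝ → ℝ} {θ : Fin m → ℝ → ℝ}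
    {U : Set ℝ} (hU : IsOpen U) (hU' : IsPreconnected U)
    (hρ : ∀ t ∈ U, ∀ j, 0 < α j + qsign a j * u t)
    (hw : ∀ t ∈ U, ∀ j, HasDerivAt (wFun a α u θ j)
      (wFun a α u θ j t * (conj (∏ i, wFun a α u θ i t) *
        ((qsign a j / (α j + qsign a j * u t) : ℝ) : ℂ))) t) :
    ∃ A : ℝ, ∀ t ∈ U, Real.sqrt (quadProd a α (u t)) * Real.sin (∑ j, θ j t) = A := by
  have hd : ∀ t ∈ U, HasDerivAt (fun τ => (∏ j, wFun a α u θ j τ).im) 0 t := by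
    intro t ht
    have h := HasDerivAt.fun_finsetProd (u := Finset.univ) fun j _ => hw t ht j
    have h' := Complex.imCLM.hasFDerivAt.comp_hasDerivAt t h
    refine h'.congr_deriv ?_
    rw [Complex.imCLM_apply, Complex.im_sum]
    refine Finset.sum_eq_zero fun j _ => ?_
    rw [smul_eq_mul, ← mul_assoc, Finset.prod_erase_mul _ _ (Finset.mem_univ j), ← mul_assoc,
      Complex.mul_conj, Complex.im_mul_ofReal, Complex.ofReal_im, zero_mul]
  obtain ⟨A, hA⟩ := hU.exists_is_const_of_deriv_eq_zero hU'
    (fun t ht => (hd t ht).differentiableAt.differentiableWithinAt) fun t ht => (hd t ht).deriv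
  refine ⟨A, fun t ht => ?_⟩
  rw [← hA t ht, prod_wFun (hρ t ht), Complex.im_ofReal_mul, Complex.add_im,
    Complex.ofReal_im, Complex.im_ofReal_mul, Complex.I_im, zero_add, mul_one]

/-- Angle form of the non-centred quadric evolution (ambient dimension
written as `m + 1`, with `m` functions `θ_j`): the quantity `Q(u)^{1/2} sin θ ≡ A` is
constant, and with `w_j = e^{iθ_j}√(α_j ± u)` and `β(t) = ½u(t) − iAt` the tangent planes
spanned along the paraboloid `∑ ± x_j² + 2x_{m+1} = 0` are special Lagrangian whenever
they have real dimension `m + 1`. -/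
theorem evolving_noncentred_quadrics_angle_form
    (m a : ℕ) (hm : 1 ≤ m) (ha1 : m ≤ 2 * a) (ham : a ≤ m) (ε : ℝ)
    (α : Fin m → ℝ) (u : ℝ → ℝ) (θ : Fin m → ℝ → ℝ)
    (hpos : ∀ j : Fin m, ∀ t ∈ Set.Ioo (-ε) ε,
      0 < (if (j : ℕ) < a then α j + u t else α j - u t))
    (hu : ∀ t ∈ Set.Ioo (-ε) ε,
      HasDerivAt u (2 * Real.sqrt (quadProd a α (u t)) * Real.cos (∑ j, θ j t)) t)
    (hθ : ∀ j : Fin m, ∀ t ∈ Set.Ioo (-ε) ε,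
      HasDerivAt (θ j)
        (if (j : ℕ) < a then
          -(Real.sqrt (quadProd a α (u t)) * Real.sin (∑ i, θ i t)) / (α j + u t)
        else
          (Real.sqrt (quadProd a α (u t)) * Real.sin (∑ i, θ i t)) / (α j - u t)) t) :
    ∃ A : ℝ,
      (∀ t ∈ Set.Ioo (-ε) ε,
        Real.sqrt (quadProd a α (u t)) * Real.sin (∑ j, θ j t) = A) ∧
      ∀ t ∈ Set.Ioo (-ε) ε, ∀ x : Fin (m + 1) → ℝ,
        (∑ j : Fin m, qsign a j * x (Fin.castSucc j) ^ 2 + 2 * x (Fin.last m) = 0) →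
        ∀ V : Submodule ℝ (Fin (m + 1) → ℂ),
          V = Submodule.span ℝ
            (({Fin.snoc
                (fun j : Fin m =>
                  deriv (fun τ => wFun a α u θ j τ) t * (x (Fin.castSucc j) : ℂ))
                ((Real.sqrt (quadProd a α (u t)) * Real.cos (∑ j, θ j t) : ℝ) -
                  Complex.I * (A : ℝ))} : Set (Fin (m + 1) → ℂ)) ∪
             {z | ∃ y : Fin (m + 1) → ℝ,
                (∑ j : Fin m, qsign a j * x (Fin.castSucc j) * y (Fin.castSucc j)
                  + y (Fin.last m) = 0) ∧
                z = Fin.snoc (fun j : Fin m => wFun a α u θ j t * (y (Fin.castSucc j) : ℂ))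
                  ((y (Fin.last m) : ℂ))}) →
          Module.finrank ℝ V = m + 1 → IsSpecialLagrangianPlane V := by
  have hρ : ∀ t ∈ Set.Ioo (-ε) ε, ∀ j, 0 < α j + qsign a j * u t := fun t ht j => by
    simpa only [ite_add_sub_eq_qsign] using hpos j t ht
  have hconj : ∀ t ∈ Set.Ioo (-ε) ε, conj (∏ j, wFun a α u θ j t) =
      (Real.sqrt (quadProd a α (u t)) : ℝ) * ((Real.cos (∑ j, θ j t) : ℝ) -
        (Real.sin (∑ j, θ j t) : ℝ) * Complex.I) := fun t ht => by
    rw [prod_wFun (hρ t ht), map_mul, map_add, map_mul, Complex.conj_ofReal, Complex.conj_ofReal,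
      Complex.conj_ofReal, Complex.conj_I]
    ring
  have hw : ∀ t ∈ Set.Ioo (-ε) ε, ∀ j, HasDerivAt (wFun a α u θ j)
      (wFun a α u θ j t * (conj (∏ i, wFun a α u θ i t) *
        ((qsign a j / (α j + qsign a j * u t) : ℝ) : ℂ))) t := fun t ht j => by
    rw [hconj t ht]
    refine hasDerivAt_wFun (hρ t ht j) (hu t ht) ((hθ j t ht).congr_deriv ?_)
    unfold qsign
    split_ifs
    · ring
    · ring
  obtain ⟨A, hA⟩ := exists_sqrt_quadProd_mul_sin_eq isOpen_Ioo isPreconnected_Ioo hρ hw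
  refine ⟨A, hA, fun t ht x _ V hV hdim => ?_⟩
  have hκ : conj (∏ j, wFun a α u θ j t) =
      (Real.sqrt (quadProd a α (u t)) * Real.cos (∑ j, θ j t) : ℝ) - Complex.I * (A : ℝ) := by
    rw [hconj t ht, ← hA t ht]
    push_cast
    ring
  refine isSpecialLagrangianPlane_of_diagonal
    (W := Fin.snoc (α := fun _ => ℂ) (fun j => wFun a α u θ j t) 1)
    (ξ := Fin.snoc (α := fun _ => ℝ)
      (fun j => qsign a j / (α j + qsign a j * u t) * x j.castSucc) 1)
    (n := Fin.snoc (α := fun _ => ℝ) (fun j => qsign a j * x j.castSucc) 1)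
    (κ := conj (∏ j, wFun a α u θ j t)) ?_ ?_ ?_ ?_ hdim
  · intro i
    refine Fin.lastCases ?_ (fun j => ?_) i
    · simp
    · have := (hρ t ht j).ne'
      simp only [Fin.snoc_castSucc, normSq_wFun (hρ t ht j)]
      field_simp
  · intro h
    simpa using congrFun h (Fin.last m)
  · rw [Fin.prod_univ_castSucc]
    simp only [Fin.snoc_castSucc, Fin.snoc_last, mul_one, Complex.mul_conj, Complex.ofReal_im]
  · intro v hv
    rw [hV] at hv
    induction hv using Submodule.span_induction with
    | mem v hv =>
      rcases hv with rfl | ⟨y, hy, rfl⟩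
      · refine ⟨1, 0, by simp, fun i => ?_⟩
        refine Fin.lastCases ?_ (fun j => ?_) i
        · simp only [Fin.snoc_last, ← hκ]
          simp
        · simp only [Fin.snoc_castSucc, (hw t ht j).deriv]
          push_cast
          simp
          ring
      · refine ⟨0, y, by simpa [Fin.sum_univ_castSucc] using hy, fun i => ?_⟩
        refine Fin.lastCases ?_ (fun j => ?_) i <;> simp
    | zero => exact ⟨0, 0, by simp, by simp⟩
    | add v w _ _ hv hw =>
      obtain ⟨c, y, hy, hvy⟩ := hv
      obtain ⟨d, z, hz, hwz⟩ := hw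
      refine ⟨c + d, y + z, ?_, fun i => ?_⟩
      · simp only [Pi.add_apply, mul_add, Finset.sum_add_distrib, hy, hz, add_zero]
      · rw [Pi.add_apply, hvy, hwz, Pi.add_apply]
        push_cast
        ring
    | smul r v _ hv =>
      obtain ⟨c, y, hy, hvy⟩ := hv
      refine ⟨r * c, r • y, ?_, fun i => ?_⟩
      · simp only [Pi.smul_apply, smul_eq_mul, mul_left_comm _ r, ← Finset.mul_sum, hy, mul_zero]
      · rw [Pi.smul_apply, hvy, Pi.smul_apply, Complex.real_smul, smul_eq_mul]
        push_cast
        ring
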